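/- Let γ₀, γ₁ > 0. There exists a constant C > 0 depending only on γ₀ and γ₁ such that the following holds. Let K ⊂ ℝ² be an open polygon with diameter d whose boundary ∂K is the union of closed straight edges meeting only at the vertices; assume K is star-shaped with respect to every point of a closed ball of radius γ₀ d contained in K and the distance between any two vertices of K is at least γ₁ d. Then for every real-valued function u continuously differentiable on a neighborhood of the closure of K, ∫_{∂K} (u − ū^K)² dℋ¹ ≤ C d ∫_K |∇u|², where ū^K = |K|⁻¹ ∫_K u. (Combined trace–Poincaré estimate: h_e⁻¹ ‖u − ū^K‖²_{0,∂K} ≲ |u|²_{1,K} for shape-regular polygons.) -/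

import Mathlib

open MeasureTheory

open scoped ENNReal

/-- The Euclidean plane. -/
abbrev Plane := EuclideanSpace ℝ (Fin 2)

theorem lintegral_comp_smul_add_le {G : Plane → ℝ≥0∞} (hG : Measurable G) {r : ℝ}
    (hr : 1 / 2 ≤ r) (b : Plane) : ∫⁻ y, G (r • y + b) ≤ 4 * ∫⁻ z, G z := by
  have hr0 : 0 < r := by linarith
  have h1 : ∫⁻ y, G (r • y + b) = ∫⁻ z, G (z + b) ∂(Measure.map (r • ·) volume) := by
    rw [lintegral_map (f := fun z => G (z + b)) (hG.comp (measurable_add_const b))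
      (measurable_const_smul r)]
  rw [h1, Measure.map_addHaar_smul _ hr0.ne', lintegral_smul_measure,
    lintegral_add_right_eq_self, smul_eq_mul]
  gcongr
  rw [show (4 : ℝ≥0∞) = ENNReal.ofReal 4 by norm_num]
  apply ENNReal.ofReal_le_ofReal
  rw [finrank_euclideanSpace_fin, abs_of_pos (by positivity), inv_le_comm₀ (by positivity)
    (by norm_num)]
  nlinarith

theorem lintegral_comp_linear_combination {G : Plane → ℝ≥0∞} (hG : Measurable G) (b a e : Plane)
    (hdet : a 0 * e 1 - a 1 * e 0 ≠ 0) :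
    ∫⁻ s : ℝ, ∫⁻ t : ℝ, G (b + s • a + t • e) =
      ENNReal.ofReal |a 0 * e 1 - a 1 * e 0|⁻¹ * ∫⁻ z, G z := by
  let β := (EuclideanSpace.basisFun (Fin 2) ℝ).toBasis
  let M : Plane →ₗ[ℝ] Plane := Matrix.toLin β β !![a 0, e 0; a 1, e 1]
  have hM : ∀ w : Plane, M w = w 0 • a + w 1 • e := by
    intro w
    ext i
    fin_cases i <;> simp [M, β, Matrix.toLin_apply, Matrix.mulVec, dotProduct, Fin.sum_univ_two] <;>
      ring
  have hMdet : LinearMap.det M = a 0 * e 1 - a 1 * e 0 := by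
    simp only [M, LinearMap.det_toLin, Matrix.det_fin_two_of]
    ring
  have hmap := Measure.map_linearMap_addHaar_eq_smul_addHaar (μ := (volume : Measure Plane))
    (f := M) (by rwa [hMdet])
  have h1 : ∫⁻ w, G (b + M w) = ENNReal.ofReal |a 0 * e 1 - a 1 * e 0|⁻¹ * ∫⁻ z, G z := by
    rw [← lintegral_map (f := fun z => G (b + z)) (hG.comp (measurable_const_add b))
      M.continuous_of_finiteDimensional.measurable, hmap, lintegral_smul_measure,
      lintegral_add_left_eq_self, hMdet, smul_eq_mul, abs_inv]
  rw [← h1]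
  have hφ : MeasurePreserving (fun w : Plane => ((w 0, w 1) : ℝ × ℝ)) :=
    (volume_preserving_finTwoArrow ℝ).comp (PiLp.volume_preserving_ofLp (Fin 2))
  have hm : Measurable fun q : ℝ × ℝ => G (b + q.1 • a + q.2 • e) := by fun_prop
  have h2 := hφ.lintegral_comp hm
  simp only [hM, ← add_assoc]
  rw [h2, Measure.volume_eq_prod, lintegral_prod _ hm.aemeasurable]

theorem lintegral_triangle_le {G : Plane → ℝ≥0∞} (hG : Measurable G) (y A e : Plane) (L : ℝ)
    {δ : ℝ} (hδ : 0 < δ)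
    (hdet : δ ≤ |(A - y) 0 * e 1 - (A - y) 1 * e 0|) :
    ∫⁻ t in Set.Icc 0 L, ∫⁻ s in Set.Icc (1 / 2 : ℝ) 1, G (y + s • (A + t • e - y)) ≤
      ENNReal.ofReal (2 / δ) * ∫⁻ z, G z := by
  have hd0 : (A - y) 0 * e 1 - (A - y) 1 * e 0 ≠ 0 := by
    intro h
    rw [h, abs_zero] at hdet
    linarith
  have hm : Measurable fun q : ℝ × ℝ => G (y + q.2 • (A + q.1 • e - y)) := by fun_prop
  rw [lintegral_lintegral_swap (f := fun t s => G (y + s • (A + t • e - y))) hm.aemeasurable]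
  calc ∫⁻ s in Set.Icc (1 / 2 : ℝ) 1, ∫⁻ t in Set.Icc 0 L, G (y + s • (A + t • e - y))
      ≤ ∫⁻ s in Set.Icc (1 / 2 : ℝ) 1, 2 * ∫⁻ t : ℝ, G (y + s • (A - y) + t • e) := by
        refine setLIntegral_mono' measurableSet_Icc fun s hs => ?_
        have hs0 : 0 < s := by linarith [hs.1]
        refine (setLIntegral_le_lintegral _ _).trans ?_
        have hm' : Measurable fun t : ℝ => G (y + s • (A - y) + t • e) := by fun_prop
        have h1 : ∫⁻ t : ℝ, G (y + s • (A + t • e - y)) =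
            ∫⁻ t, G (y + s • (A - y) + t • e) ∂(Measure.map (s * ·) volume) := by
          rw [lintegral_map hm' (measurable_const_mul s)]
          refine lintegral_congr fun t => ?_
          congr 1
          module
        rw [h1, Real.map_volume_mul_left hs0.ne', lintegral_smul_measure, smul_eq_mul]
        gcongr
        rw [show (2 : ℝ≥0∞) = ENNReal.ofReal 2 by norm_num]
        apply ENNReal.ofReal_le_ofReal
        rw [abs_of_pos (by positivity), inv_le_comm₀ (by positivity) (by norm_num)]
        linarith [hs.1]
    _ ≤ 2 * ∫⁻ s : ℝ, ∫⁻ t : ℝ, G (y + s • (A - y) + t • e) := by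
        rw [lintegral_const_mul' _ _ (by norm_num)]
        exact mul_le_mul_right (setLIntegral_le_lintegral _ _) _
    _ ≤ ENNReal.ofReal (2 / δ) * ∫⁻ z, G z := by
        rw [lintegral_comp_linear_combination hG y (A - y) e hd0, ← mul_assoc]
        gcongr
        have h2 : ENNReal.ofReal 2 = 2 := by norm_num
        rw [div_eq_mul_inv, ENNReal.ofReal_mul zero_le_two, h2]
        gcongr

/-- Integrating along the segments joining `y ∈ S` to `p`: on the half of a segment close to `y`
one changes variables in `y`; the other half is controlled by the assumption `hM`. -/
theorem lintegral_segments_le {G : Plane → ℝ≥0∞} (hG : Measurable G) (ν : Measure Plane)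
    [SFinite ν] {S : Set Plane} (hS : MeasurableSet S) {M : ℝ≥0∞}
    (hM : ∀ y ∈ S, ∫⁻ p, (∫⁻ s in Set.Icc (1 / 2 : ℝ) 1, G (y + s • (p - y))) ∂ν ≤ M) :
    ∫⁻ p, (∫⁻ y in S, ∫⁻ s in Set.Icc (0 : ℝ) 1, G (y + s • (p - y))) ∂ν ≤
      4 * ν Set.univ * (∫⁻ z, G z) + volume S * M := by
  have hm3 : Measurable fun q : (Plane × Plane) × ℝ => G (q.1.2 + q.2 • (q.1.1 - q.1.2)) := by
    fun_prop
  have hm2 : ∀ I : Set ℝ, Measurable fun q : Plane × Plane =>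
      ∫⁻ s in I, G (q.2 + s • (q.1 - q.2)) := fun I => hm3.lintegral_prod_right'
  have hsplit : ∀ p y : Plane, ∫⁻ s in Set.Icc (0 : ℝ) 1, G (y + s • (p - y)) ≤
      (∫⁻ s in Set.Icc (0 : ℝ) (1 / 2), G (y + s • (p - y))) +
        ∫⁻ s in Set.Icc (1 / 2 : ℝ) 1, G (y + s • (p - y)) := by
    intro p y
    rw [← Set.Icc_union_Icc_eq_Icc (show (0 : ℝ) ≤ 1 / 2 by norm_num) (by norm_num)]
    exact lintegral_union_le _ _ _
  calc ∫⁻ p, (∫⁻ y in S, ∫⁻ s in Set.Icc (0 : ℝ) 1, G (y + s • (p - y))) ∂ν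
      ≤ ∫⁻ p, ((∫⁻ y in S, ∫⁻ s in Set.Icc (0 : ℝ) (1 / 2), G (y + s • (p - y))) +
          ∫⁻ y in S, ∫⁻ s in Set.Icc (1 / 2 : ℝ) 1, G (y + s • (p - y))) ∂ν := by
        refine lintegral_mono fun p => ?_
        exact (lintegral_mono (hsplit p)).trans_eq
          (lintegral_add_left ((hm2 (Set.Icc 0 (1 / 2))).comp measurable_prodMk_left) _)
    _ = (∫⁻ p, (∫⁻ y in S, ∫⁻ s in Set.Icc (0 : ℝ) (1 / 2), G (y + s • (p - y))) ∂ν) +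
          ∫⁻ p, (∫⁻ y in S, ∫⁻ s in Set.Icc (1 / 2 : ℝ) 1, G (y + s • (p - y))) ∂ν :=
        lintegral_add_left (hm2 _).lintegral_prod_right' _
    _ ≤ 4 * ν Set.univ * (∫⁻ z, G z) + volume S * M := by
        refine add_le_add ?_ ?_
        · have hp : ∀ p, ∫⁻ y in S, ∫⁻ s in Set.Icc (0 : ℝ) (1 / 2), G (y + s • (p - y)) ≤
              4 * ∫⁻ z, G z := by
            intro p
            have hmp : Measurable fun q : Plane × ℝ => G (q.1 + q.2 • (p - q.1)) := by fun_prop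
            refine (setLIntegral_le_lintegral _ _).trans ?_
            rw [lintegral_lintegral_swap (f := fun y s => G (y + s • (p - y))) hmp.aemeasurable]
            calc _ ≤ ∫⁻ s in Set.Icc (0 : ℝ) (1 / 2), 4 * ∫⁻ z, G z := by
                  refine setLIntegral_mono' measurableSet_Icc fun s hs => ?_
                  have h : ∀ y : Plane, y + s • (p - y) = (1 - s) • y + s • p := by
                    intro y
                    module
                  simp only [h]
                  exact lintegral_comp_smul_add_le hG (by linarith [hs.2]) _
              _ ≤ 4 * ∫⁻ z, G z := by
                  rw [lintegral_const, Measure.restrict_apply_univ, Real.volume_Icc]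
                  refine mul_le_of_le_one_right' ?_
                  rw [ENNReal.ofReal_le_one]
                  norm_num
          refine (lintegral_mono hp).trans_eq ?_
          rw [lintegral_const]
          ring
        · rw [lintegral_lintegral_swap (hm2 _).aemeasurable]
          refine (setLIntegral_mono' hS hM).trans_eq ?_
          rw [setLIntegral_const, mul_comm]

theorem sq_lintegral_le {α : Type*} [MeasurableSpace α] (μ : Measure α) {f : α → ℝ≥0∞}
    (hf : AEMeasurable f μ) : (∫⁻ a, f a ∂μ) ^ 2 ≤ μ Set.univ * ∫⁻ a, f a ^ 2 ∂μ := by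
  have h := ENNReal.lintegral_mul_le_Lp_mul_Lq μ Real.HolderConjugate.two_two
    (aemeasurable_const (b := (1 : ℝ≥0∞))) hf
  simp only [Pi.mul_apply, one_mul, ENNReal.one_rpow, lintegral_const] at h
  calc (∫⁻ a, f a ∂μ) ^ 2
      ≤ (μ Set.univ ^ (1 / (2 : ℝ)) * (∫⁻ a, f a ^ (2 : ℝ) ∂μ) ^ (1 / (2 : ℝ))) ^ 2 := by
        gcongr
    _ = μ Set.univ * ∫⁻ a, f a ^ 2 ∂μ := by
        rw [mul_pow, ← ENNReal.rpow_mul_natCast, ← ENNReal.rpow_mul_natCast]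
        simp

theorem mem_of_mem_closure_of_starShaped {K V : Set Plane} (hV : IsOpen V)
    (hstar : ∀ y ∈ V, ∀ z ∈ K, segment ℝ y z ⊆ K) {y z : Plane} (hy : y ∈ V)
    (hz : z ∈ closure K) {s : ℝ} (hs0 : 0 ≤ s) (hs1 : s < 1) : y + s • (z - y) ∈ K := by
  have h1s : 1 - s ≠ 0 := by linarith
  let φ : Plane → Plane := fun w => (1 - s)⁻¹ • (y + s • (z - y) - s • w)
  have hφ : Continuous φ := by fun_prop
  have hφz : φ z = y := by
    have : y + s • (z - y) - s • z = (1 - s) • y := by module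
    simp only [φ, this, smul_smul, inv_mul_cancel₀ h1s, one_smul]
  have hmem : φ ⁻¹' V ∈ nhds z := (hV.preimage hφ).mem_nhds (by simpa [hφz] using hy)
  obtain ⟨w, hwV, hwK⟩ := mem_closure_iff_nhds.1 hz _ hmem
  refine hstar (φ w) hwV w hwK ⟨1 - s, s, by linarith, hs0, by ring, ?_⟩
  simp only [φ, smul_smul, mul_inv_cancel₀ h1s, one_smul]
  module

theorem enorm_sub_sq_le {u : Plane → ℝ} {K U : Set Plane} (hU : IsOpen U) (hKU : closure K ⊆ U)
    (hu : ContDiffOn ℝ 1 u U) {y p : Plane} (hp : p ∈ closure K)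
    (hseg : ∀ s : ℝ, 0 ≤ s → s < 1 → y + s • (p - y) ∈ K) :
    ‖u p - u y‖ₑ ^ 2 ≤ ‖p - y‖ₑ ^ 2 * ∫⁻ s in Set.Icc (0 : ℝ) 1,
      K.indicator (fun z => ‖fderiv ℝ u z‖ₑ ^ 2) (y + s • (p - y)) := by
  have hmem : ∀ s ∈ Set.Icc (0 : ℝ) 1, y + s • (p - y) ∈ U := by
    intro s hs
    rcases hs.2.lt_or_eq with h | h
    · exact hKU (subset_closure (hseg s hs.1 h))
    · rw [h]
      simpa using hKU hp
  have hcont : ContinuousOn (fun s : ℝ => fderiv ℝ u (y + s • (p - y))) (Set.Icc 0 1) :=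
    (hu.continuousOn_fderiv_of_isOpen hU le_rfl).comp (by fun_prop) hmem
  have hcont' : ContinuousOn (fun s : ℝ => fderiv ℝ u (y + s • (p - y)) (p - y)) (Set.Icc 0 1) :=
    hcont.clm_apply continuousOn_const
  have hderiv : ∀ s ∈ Set.uIcc (0 : ℝ) 1, HasDerivAt (fun s : ℝ => u (y + s • (p - y)))
      (fderiv ℝ u (y + s • (p - y)) (p - y)) s := by
    intro s hs
    rw [Set.uIcc_of_le zero_le_one] at hs
    have h1 : HasFDerivAt u (fderiv ℝ u (y + s • (p - y))) (y + s • (p - y)) :=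
      ((hu.differentiableOn one_ne_zero).differentiableAt
        (hU.mem_nhds (hmem s hs))).hasFDerivAt
    have h2 : HasDerivAt (fun s : ℝ => y + s • (p - y)) (p - y) s := by
      simpa using ((hasDerivAt_id s).smul_const (p - y)).const_add y
    exact h1.comp_hasDerivAt s h2
  have hftc := intervalIntegral.integral_eq_sub_of_hasDerivAt hderiv
    (hcont'.intervalIntegrable_of_Icc zero_le_one)
  simp only [one_smul, zero_smul, add_zero, add_sub_cancel] at hftc
  rw [intervalIntegral.integral_of_le zero_le_one, ← integral_Icc_eq_integral_Ioc] at hftc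
  have hae : AEMeasurable (fun s : ℝ => ‖fderiv ℝ u (y + s • (p - y))‖ₑ)
      (volume.restrict (Set.Icc 0 1)) :=
    ((measurable_fderiv ℝ u).comp (by fun_prop :
      Measurable fun s : ℝ => y + s • (p - y))).enorm.aemeasurable
  rw [← hftc]
  calc _ ≤ (∫⁻ s in Set.Icc (0 : ℝ) 1, ‖p - y‖ₑ * ‖fderiv ℝ u (y + s • (p - y))‖ₑ) ^ 2 := by
        gcongr
        refine (enorm_integral_le_lintegral_enorm _).trans (lintegral_mono fun s => ?_)
        rw [mul_comm]
        exact ContinuousLinearMap.le_opENorm _ _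
    _ ≤ ‖p - y‖ₑ ^ 2 * ∫⁻ s in Set.Icc (0 : ℝ) 1, ‖fderiv ℝ u (y + s • (p - y))‖ₑ ^ 2 := by
        rw [lintegral_const_mul' _ _ enorm_ne_top, mul_pow]
        gcongr
        simpa using sq_lintegral_le _ hae
    _ = _ := by
        congr 1
        rw [← restrict_Ico_eq_restrict_Icc]
        refine setLIntegral_congr_fun measurableSet_Ico fun s hs => ?_
        rw [Set.indicator_of_mem (hseg s hs.1 hs.2)]

theorem notMem_of_mem_line_of_starShaped {K V : Set Plane} (hK : IsOpen K) (hV : IsOpen V)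
    (hVK : V ⊆ K) (hstar : ∀ y ∈ V, ∀ z ∈ K, segment ℝ y z ⊆ K) {A B : Plane}
    (hAB : segment ℝ A B ⊆ frontier K) (s : ℝ) : A + s • (B - A) ∉ V := by
  have hfr : ∀ z ∈ segment ℝ A B, z ∉ K := by
    intro z hz hzK
    have := hAB hz
    rw [hK.frontier_eq] at this
    exact this.2 hzK
  have hcl : ∀ z ∈ segment ℝ A B, z ∈ closure K := fun z hz => frontier_subset_closure (hAB hz)
  intro hq
  rcases lt_or_ge s 0 with h0 | h0
  · have h := mem_of_mem_closure_of_starShaped hV hstar hq (hcl B (right_mem_segment ℝ A B))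
      (s := -s / (1 - s)) (div_nonneg (by linarith) (by linarith))
      (by rw [div_lt_one (by linarith)]; linarith)
    refine hfr A (left_mem_segment ℝ A B) ?_
    convert h using 1
    have h1 : 1 - s ≠ 0 := by linarith
    match_scalars <;> field_simp <;> ring
  rcases le_or_gt s 1 with h1 | h1
  · exact hfr _ ⟨1 - s, s, by linarith, h0, by ring, by module⟩ (hVK hq)
  · have h := mem_of_mem_closure_of_starShaped hV hstar hq (hcl A (left_mem_segment ℝ A B))
      (s := (s - 1) / s) (div_nonneg (by linarith) (by linarith))
      (by rw [div_lt_one (by linarith)]; linarith)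
    refine hfr B (right_mem_segment ℝ A B) ?_
    convert h using 1
    have h1 : s ≠ 0 := by linarith
    match_scalars <;> field_simp <;> ring

theorem abs_det_eq_norm_sub_foot (a e : Plane) (he : ‖e‖ = 1) :
    ‖a - (a 0 * e 0 + a 1 * e 1) • e‖ = |a 0 * e 1 - a 1 * e 0| := by
  have h1 : e 0 ^ 2 + e 1 ^ 2 = 1 := by
    have := EuclideanSpace.real_norm_sq_eq e
    rw [he, Fin.sum_univ_two] at this
    linarith
  rw [← abs_norm, ← sq_eq_sq_iff_abs_eq_abs, EuclideanSpace.real_norm_sq_eq, Fin.sum_univ_two]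
  simp only [PiLp.sub_apply, PiLp.smul_apply, smul_eq_mul]
  linear_combination ((a 0 * e 0 + a 1 * e 1) ^ 2 - a 0 ^ 2 - a 1 ^ 2) * h1

theorem half_le_abs_det {K : Set Plane} (hK : IsOpen K) {c : Plane} {r : ℝ}
    (hVK : Metric.ball c r ⊆ K) (hstar : ∀ y ∈ Metric.ball c r, ∀ z ∈ K, segment ℝ y z ⊆ K)
    {A B e : Plane} (he : ‖e‖ = 1) (hBe : B = A + ‖B - A‖ • e) (hne : A ≠ B)
    (hAB : segment ℝ A B ⊆ frontier K) {y : Plane} (hy : y ∈ Metric.ball c (r / 2)) :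
    r / 2 ≤ |(A - y) 0 * e 1 - (A - y) 1 * e 0| := by
  have hL : ‖B - A‖ ≠ 0 := norm_ne_zero_iff.2 (sub_ne_zero.2 hne.symm)
  rw [← abs_det_eq_norm_sub_foot _ _ he]
  set k := (A - y) 0 * e 0 + (A - y) 1 * e 1
  have h := notMem_of_mem_line_of_starShaped hK Metric.isOpen_ball hVK hstar hAB (-k / ‖B - A‖)
  have h3 : B - A = ‖B - A‖ • e := sub_eq_iff_eq_add'.2 hBe
  have h2 : A + (-k / ‖B - A‖) • (B - A) = A - k • e := by
    nth_rw 2 [h3]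
    rw [smul_smul, div_mul_cancel₀ _ hL]
    module
  rw [h2, Metric.mem_ball, not_lt] at h
  rw [Metric.mem_ball] at hy
  have h4 := dist_triangle (A - k • e) y c
  have h5 : dist (A - k • e) y = ‖A - y - k • e‖ := by
    rw [dist_eq_norm]
    congr 1
    module
  linarith

theorem hausdorffMeasure_restrict_segment {A B e : Plane} (he : ‖e‖ = 1)
    (hBe : B = A + ‖B - A‖ • e) :
    (μH[1] : Measure Plane).restrict (segment ℝ A B) =
      Measure.map (fun t : ℝ => A + t • e) (volume.restrict (Set.Icc 0 ‖B - A‖)) := by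
  have hiso : Isometry fun t : ℝ => A + t • e := by
    refine Isometry.of_dist_eq fun s t => ?_
    rw [dist_add_left, dist_eq_norm, ← sub_smul, norm_smul, he, mul_one, Real.dist_eq,
      Real.norm_eq_abs]
  have hseg : segment ℝ A B = (fun t : ℝ => A + t • e) '' Set.Icc 0 ‖B - A‖ := by
    have h3 : B - A = ‖B - A‖ • e := sub_eq_iff_eq_add'.2 hBe
    rw [segment_eq_image']
    ext z
    constructor
    · rintro ⟨θ, hθ, rfl⟩
      refine ⟨θ * ‖B - A‖, ⟨mul_nonneg hθ.1 (norm_nonneg _),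
        mul_le_of_le_one_left (norm_nonneg _) hθ.2⟩, ?_⟩
      simp only
      nth_rw 2 [h3]
      rw [smul_smul]
    · rintro ⟨t, ht, rfl⟩
      rcases eq_or_ne ‖B - A‖ 0 with h | h
      · rw [h] at ht
        have : t = 0 := le_antisymm ht.2 ht.1
        exact ⟨0, by simp, by simp [this]⟩
      · refine ⟨t / ‖B - A‖, ⟨div_nonneg ht.1 (norm_nonneg _),
          div_le_one_of_le₀ ht.2 (norm_nonneg _)⟩, ?_⟩
        simp only
        nth_rw 2 [h3]
        rw [smul_smul, div_mul_cancel₀ _ h]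
  have hemb := hiso.isClosedEmbedding.measurableEmbedding
  rw [hseg, ← hausdorffMeasure_real, ← Set.preimage_image_eq (Set.Icc 0 ‖B - A‖) hiso.injective,
    ← hemb.restrict_map, hiso.map_hausdorffMeasure (Or.inl zero_le_one),
    Measure.restrict_restrict_of_subset (Set.image_subset_range _ _),
    Set.preimage_image_eq _ hiso.injective]

theorem dist_le_diam_of_mem_closure {K : Set Plane} (hb : Bornology.IsBounded K) {x y : Plane}
    (hx : x ∈ closure K) (hy : y ∈ closure K) : dist x y ≤ Metric.diam K := by
  rw [← Metric.diam_closure]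
  exact Metric.dist_le_diam_of_mem hb.closure hx hy

theorem enorm_sub_sq_le_of_starShaped {u : Plane → ℝ} {K U V : Set Plane}
    (hb : Bornology.IsBounded K) (hU : IsOpen U) (hKU : closure K ⊆ U) (hu : ContDiffOn ℝ 1 u U)
    (hV : IsOpen V) (hVK : V ⊆ K) (hstar : ∀ y ∈ V, ∀ z ∈ K, segment ℝ y z ⊆ K)
    {p y : Plane} (hp : p ∈ closure K) (hy : y ∈ V) :
    ‖u p - u y‖ₑ ^ 2 ≤ ENNReal.ofReal (Metric.diam K) ^ 2 * ∫⁻ s in Set.Icc (0 : ℝ) 1,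
      K.indicator (fun z => ‖fderiv ℝ u z‖ₑ ^ 2) (y + s • (p - y)) := by
  refine (enorm_sub_sq_le hU hKU hu hp fun s hs0 hs1 =>
    mem_of_mem_closure_of_starShaped hV hstar hy hp hs0 hs1).trans ?_
  gcongr
  rw [← ofReal_norm, ← dist_eq_norm]
  exact ENNReal.ofReal_le_ofReal
    (dist_le_diam_of_mem_closure hb hp (subset_closure (hVK hy)))

theorem measurable_indicator_enorm_fderiv_sq (u : Plane → ℝ) {K : Set Plane} (hK : IsOpen K) :
    Measurable (K.indicator fun z => ‖fderiv ℝ u z‖ₑ ^ 2) :=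
  ((measurable_fderiv ℝ u).enorm.pow_const 2).indicator hK.measurableSet

/-- The double integral over `K` and a subset `S` of the kernel of `K` of the squared differences
of `u` is bounded by the Dirichlet energy. -/
theorem lintegral_lintegral_enorm_sub_sq_le {u : Plane → ℝ} {K U V S : Set Plane} (hK : IsOpen K)
    (hb : Bornology.IsBounded K) (hU : IsOpen U) (hKU : closure K ⊆ U) (hu : ContDiffOn ℝ 1 u U)
    (hV : IsOpen V) (hVK : V ⊆ K) (hstar : ∀ y ∈ V, ∀ z ∈ K, segment ℝ y z ⊆ K)
    (hS : MeasurableSet S) (hSV : S ⊆ V) :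
    ∫⁻ y in S, ∫⁻ x in K, ‖u x - u y‖ₑ ^ 2 ≤
      8 * ENNReal.ofReal (Metric.diam K) ^ 2 * volume K * ∫⁻ z in K, ‖fderiv ℝ u z‖ₑ ^ 2 := by
  set G := K.indicator fun z => ‖fderiv ℝ u z‖ₑ ^ 2
  have hG : Measurable G := measurable_indicator_enorm_fderiv_sq u hK
  have hΓ : ∫⁻ z in K, ‖fderiv ℝ u z‖ₑ ^ 2 = ∫⁻ z, G z :=
    (lintegral_indicator hK.measurableSet _).symm
  have hm3 : Measurable fun q : (Plane × Plane) × ℝ => G (q.1.1 + q.2 • (q.1.2 - q.1.1)) := by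
    fun_prop
  have hm2 : Measurable fun q : Plane × Plane =>
      ∫⁻ s in Set.Icc (0 : ℝ) 1, G (q.1 + s • (q.2 - q.1)) := hm3.lintegral_prod_right'
  have hM : ∀ y ∈ S, ∫⁻ p in K, ∫⁻ s in Set.Icc (1 / 2 : ℝ) 1, G (y + s • (p - y)) ≤
      4 * ∫⁻ z, G z := by
    intro y _
    have hmp : Measurable fun q : Plane × ℝ => G (y + q.2 • (q.1 - y)) := by fun_prop
    refine (setLIntegral_le_lintegral _ _).trans ?_
    rw [lintegral_lintegral_swap (f := fun p s => G (y + s • (p - y))) hmp.aemeasurable]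
    calc _ ≤ ∫⁻ s in Set.Icc (1 / 2 : ℝ) 1, 4 * ∫⁻ z, G z := by
          refine setLIntegral_mono' measurableSet_Icc fun s hs => ?_
          have h : ∀ p : Plane, y + s • (p - y) = s • p + (1 - s) • y := by
            intro p
            module
          simp only [h]
          exact lintegral_comp_smul_add_le hG hs.1 _
      _ ≤ 4 * ∫⁻ z, G z := by
          rw [lintegral_const, Measure.restrict_apply_univ, Real.volume_Icc]
          refine mul_le_of_le_one_right' ?_
          rw [ENNReal.ofReal_le_one]
          norm_num
  calc ∫⁻ y in S, ∫⁻ x in K, ‖u x - u y‖ₑ ^ 2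
      ≤ ∫⁻ y in S, ∫⁻ x in K, ENNReal.ofReal (Metric.diam K) ^ 2 *
          ∫⁻ s in Set.Icc (0 : ℝ) 1, G (y + s • (x - y)) :=
        setLIntegral_mono' hS fun y hy => setLIntegral_mono' hK.measurableSet fun x hx =>
          enorm_sub_sq_le_of_starShaped hb hU hKU hu hV hVK hstar (subset_closure hx) (hSV hy)
    _ = ENNReal.ofReal (Metric.diam K) ^ 2 * ∫⁻ x in K, ∫⁻ y in S,
          ∫⁻ s in Set.Icc (0 : ℝ) 1, G (y + s • (x - y)) := by
        have hD : ENNReal.ofReal (Metric.diam K) ^ 2 ≠ ⊤ := ENNReal.pow_ne_top ENNReal.ofReal_ne_top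
        simp_rw [lintegral_const_mul' _ _ hD]
        rw [lintegral_lintegral_swap hm2.aemeasurable]
    _ ≤ ENNReal.ofReal (Metric.diam K) ^ 2 *
          (4 * volume K * (∫⁻ z, G z) + volume S * (4 * ∫⁻ z, G z)) := by
        gcongr
        simpa using lintegral_segments_le hG (volume.restrict K) hS hM
    _ ≤ ENNReal.ofReal (Metric.diam K) ^ 2 *
          (4 * volume K * (∫⁻ z, G z) + volume K * (4 * ∫⁻ z, G z)) := by
        gcongr
        exact hSV.trans hVK
    _ = _ := by
        rw [hΓ]
        ring

theorem enorm_sub_average_sq_le {u : Plane → ℝ} {K : Set Plane} (hu : IntegrableOn u K)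
    (hK0 : volume K ≠ 0) (hK : volume K ≠ ⊤) (a : ℝ) :
    ‖a - (volume K).toReal⁻¹ * ∫ z in K, u z‖ₑ ^ 2 ≤
      (volume K)⁻¹ * ∫⁻ x in K, ‖u x - a‖ₑ ^ 2 := by
  have : IsFiniteMeasure (volume.restrict K) := isFiniteMeasure_restrict.2 hK
  have hk : (volume K).toReal ≠ 0 := ENNReal.toReal_ne_zero.2 ⟨hK0, hK⟩
  have h1 : a - (volume K).toReal⁻¹ * ∫ z in K, u z =
      -((volume K).toReal⁻¹ * ∫ z in K, (u z - a)) := by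
    rw [integral_sub hu (integrable_const a), setIntegral_const, smul_eq_mul, measureReal_def]
    field_simp
    ring
  have hae : AEMeasurable (fun x => ‖u x - a‖ₑ) (volume.restrict K) :=
    (hu.aestronglyMeasurable.aemeasurable.sub_const a).enorm
  have h2 : ‖(volume K).toReal⁻¹‖ₑ = (volume K)⁻¹ := by
    rw [enorm_inv hk, Real.enorm_eq_ofReal ENNReal.toReal_nonneg, ENNReal.ofReal_toReal hK]
  rw [h1, enorm_neg, enorm_mul, mul_pow, h2]
  calc _ ≤ (volume K)⁻¹ ^ 2 * (volume K * ∫⁻ x in K, ‖u x - a‖ₑ ^ 2) := by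
        gcongr
        refine (pow_le_pow_left' (enorm_integral_le_lintegral_enorm _) 2).trans ?_
        simpa using sq_lintegral_le _ hae
    _ = (volume K)⁻¹ * ((volume K)⁻¹ * volume K) * ∫⁻ x in K, ‖u x - a‖ₑ ^ 2 := by ring
    _ = _ := by rw [ENNReal.inv_mul_cancel hK0 hK, mul_one]

theorem enorm_sub_sq_le_two_mul_add (a b c : ℝ) :
    ‖a - c‖ₑ ^ 2 ≤ 2 * ‖a - b‖ₑ ^ 2 + 2 * ‖b - c‖ₑ ^ 2 := by
  simp only [← ofReal_norm, Real.norm_eq_abs]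
  have h2 : (2 : ℝ≥0∞) = ENNReal.ofReal 2 := by norm_num
  rw [h2, ← ENNReal.ofReal_pow (abs_nonneg _), ← ENNReal.ofReal_pow (abs_nonneg _),
    ← ENNReal.ofReal_pow (abs_nonneg _), ← ENNReal.ofReal_mul zero_le_two,
    ← ENNReal.ofReal_mul zero_le_two, ← ENNReal.ofReal_add (by positivity) (by positivity)]
  apply ENNReal.ofReal_le_ofReal
  simp only [sq_abs]
  nlinarith [sq_nonneg (a - b - (b - c))]

theorem ofReal_le_volume_ball_half (c : Plane) {r : ℝ} (hr : 0 < r) :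
    ENNReal.ofReal (r ^ 2 / 2) ≤ volume (Metric.ball c (r / 2)) := by
  rw [EuclideanSpace.volume_ball_fin_two, ← ENNReal.ofReal_pow (by positivity)]
  rw [← ENNReal.ofReal_mul (by positivity)]
  apply ENNReal.ofReal_le_ofReal
  nlinarith [Real.pi_gt_three, sq_nonneg r]

/-- The combined trace and Poincaré estimate on a single edge. -/
theorem lintegral_segment_enorm_sub_average_sq_le {u : Plane → ℝ} {K U : Set Plane}
    (hK : IsOpen K) (hb : Bornology.IsBounded K) (hU : IsOpen U) (hKU : closure K ⊆ U)
    (hu : ContDiffOn ℝ 1 u U) {c : Plane} {r : ℝ} (hr : 0 < r) (hVK : Metric.ball c r ⊆ K)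
    (hstar : ∀ y ∈ Metric.ball c r, ∀ z ∈ K, segment ℝ y z ⊆ K) {A B : Plane} (hne : A ≠ B)
    (hAB : segment ℝ A B ⊆ frontier K) :
    ∫⁻ p in segment ℝ A B, ‖u p - (volume K).toReal⁻¹ * ∫ z in K, u z‖ₑ ^ 2 ∂μH[1] ≤
      ENNReal.ofReal (48 * Metric.diam K ^ 3 / r ^ 2 + 8 * Metric.diam K ^ 2 / r) *
        ∫⁻ z in K, ‖fderiv ℝ u z‖ₑ ^ 2 := by
  set S := Metric.ball c (r / 2)
  set ubar := (volume K).toReal⁻¹ * ∫ z in K, u z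
  set Γ := ∫⁻ z in K, ‖fderiv ℝ u z‖ₑ ^ 2
  set d := Metric.diam K
  set D := ENNReal.ofReal d
  set ν := (μH[1] : Measure Plane).restrict (segment ℝ A B)
  set G := K.indicator fun z => ‖fderiv ℝ u z‖ₑ ^ 2
  have hd0 : 0 ≤ d := Metric.diam_nonneg
  have hG : Measurable G := measurable_indicator_enorm_fderiv_sq u hK
  have hΓ : ∫⁻ z, G z = Γ := lintegral_indicator hK.measurableSet _
  have hL0 : ‖B - A‖ ≠ 0 := norm_ne_zero_iff.2 (sub_ne_zero.2 hne.symm)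
  obtain ⟨e, he, hBe⟩ : ∃ e : Plane, ‖e‖ = 1 ∧ B = A + ‖B - A‖ • e := by
    refine ⟨‖B - A‖⁻¹ • (B - A), ?_, ?_⟩
    · rw [norm_smul, norm_inv, norm_norm, inv_mul_cancel₀ hL0]
    · rw [smul_smul, mul_inv_cancel₀ hL0, one_smul, add_sub_cancel]
  have hνmap : ν = Measure.map (fun t : ℝ => A + t • e) (volume.restrict (Set.Icc 0 ‖B - A‖)) :=
    hausdorffMeasure_restrict_segment he hBe
  have hφ : Measurable fun t : ℝ => A + t • e := by fun_prop
  have hfr : ∀ p ∈ segment ℝ A B, p ∈ closure K := fun p hp => frontier_subset_closure (hAB hp)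
  have hsegm : MeasurableSet (segment ℝ A B) := by
    rw [segment_eq_image']
    exact (isCompact_Icc.image (by fun_prop)).measurableSet
  have hνuniv : ν Set.univ ≤ D := by
    rw [hνmap, Measure.map_apply hφ MeasurableSet.univ, Set.preimage_univ,
      Measure.restrict_apply_univ, Real.volume_Icc, sub_zero, ← dist_eq_norm]
    exact ENNReal.ofReal_le_ofReal (dist_le_diam_of_mem_closure hb
      (hfr B (right_mem_segment ℝ A B)) (hfr A (left_mem_segment ℝ A B)))
  have : IsFiniteMeasure ν := ⟨hνuniv.trans_lt ENNReal.ofReal_lt_top⟩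
  have hSV : S ⊆ Metric.ball c r := Metric.ball_subset_ball (by linarith)
  have hSK : S ⊆ K := hSV.trans hVK
  have hS : MeasurableSet S := Metric.isOpen_ball.measurableSet
  have hb0 : volume S ≠ 0 := (Metric.measure_ball_pos volume c (by positivity)).ne'
  have hbtop : volume S ≠ ⊤ := measure_ball_lt_top.ne
  have hk0 : volume K ≠ 0 := fun h => hb0 (measure_mono_null hSK h)
  have hktop : volume K ≠ ⊤ := hb.measure_lt_top.ne
  have hcontu : ContinuousOn u (closure K) := hu.continuousOn.mono hKU
  have hint : IntegrableOn u K :=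
    (hcontu.integrableOn_compact hb.isCompact_closure).mono_set subset_closure
  -- the part comparing the edge with the ball
  have hM : ∀ y ∈ S, ∫⁻ p, (∫⁻ s in Set.Icc (1 / 2 : ℝ) 1, G (y + s • (p - y))) ∂ν ≤
      ENNReal.ofReal (4 / r) * Γ := by
    intro y hy
    have hm3 : Measurable fun q : Plane × ℝ => G (y + q.2 • (q.1 - y)) := by fun_prop
    rw [hνmap, lintegral_map hm3.lintegral_prod_right' hφ]
    have h := lintegral_triangle_le hG y A e ‖B - A‖ (half_pos hr)
      (half_le_abs_det hK hVK hstar he hBe hne hAB hy)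
    rw [hΓ] at h
    refine h.trans_eq ?_
    congr 2
    field_simp
    norm_num
  have hedge : ∫⁻ p, (∫⁻ y in S, ‖u p - u y‖ₑ ^ 2) ∂ν ≤
      D ^ 2 * (4 * D * Γ + volume S * (ENNReal.ofReal (4 / r) * Γ)) := by
    have hD : D ^ 2 ≠ ⊤ := ENNReal.pow_ne_top ENNReal.ofReal_ne_top
    calc ∫⁻ p, (∫⁻ y in S, ‖u p - u y‖ₑ ^ 2) ∂ν
        ≤ ∫⁻ p, (∫⁻ y in S, D ^ 2 * ∫⁻ s in Set.Icc (0 : ℝ) 1, G (y + s • (p - y))) ∂ν :=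
          setLIntegral_mono' hsegm fun p hp => setLIntegral_mono' hS fun y hy =>
            enorm_sub_sq_le_of_starShaped hb hU hKU hu Metric.isOpen_ball hVK hstar (hfr p hp)
              (hSV hy)
      _ = D ^ 2 * ∫⁻ p, (∫⁻ y in S, ∫⁻ s in Set.Icc (0 : ℝ) 1, G (y + s • (p - y))) ∂ν := by
          simp_rw [lintegral_const_mul' _ _ hD]
      _ ≤ D ^ 2 * (4 * ν Set.univ * Γ + volume S * (ENNReal.ofReal (4 / r) * Γ)) := by
          gcongr
          exact (lintegral_segments_le hG ν hS hM).trans_eq (by rw [hΓ])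
      _ ≤ _ := by gcongr
  -- the part comparing the ball with `K`
  have hball : ∫⁻ y in S, ‖u y - ubar‖ₑ ^ 2 ≤ 8 * D ^ 2 * Γ := by
    calc ∫⁻ y in S, ‖u y - ubar‖ₑ ^ 2
        ≤ ∫⁻ y in S, (volume K)⁻¹ * ∫⁻ x in K, ‖u x - u y‖ₑ ^ 2 :=
          lintegral_mono fun y => enorm_sub_average_sq_le hint hk0 hktop (u y)
      _ = (volume K)⁻¹ * ∫⁻ y in S, ∫⁻ x in K, ‖u x - u y‖ₑ ^ 2 :=
          lintegral_const_mul' _ _ (ENNReal.inv_ne_top.2 hk0)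
      _ ≤ (volume K)⁻¹ * (8 * D ^ 2 * volume K * Γ) := by
          gcongr
          exact lintegral_lintegral_enorm_sub_sq_le hK hb hU hKU hu Metric.isOpen_ball hVK hstar
            hS hSV
      _ = 8 * D ^ 2 * Γ * ((volume K)⁻¹ * volume K) := by ring
      _ = 8 * D ^ 2 * Γ := by rw [ENNReal.inv_mul_cancel hk0 hktop, mul_one]
  have haeS : AEMeasurable (fun y => 2 * ‖u y - ubar‖ₑ ^ 2) (volume.restrict S) :=
    (((hint.mono_set hSK).aestronglyMeasurable.aemeasurable.sub_const _).enorm.pow_const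
      2).const_mul 2
  have hpt : ∀ p, volume S * ‖u p - ubar‖ₑ ^ 2 ≤
      2 * (∫⁻ y in S, ‖u p - u y‖ₑ ^ 2) + 2 * (8 * D ^ 2 * Γ) := by
    intro p
    calc volume S * ‖u p - ubar‖ₑ ^ 2 = ∫⁻ y in S, ‖u p - ubar‖ₑ ^ 2 := by
          rw [setLIntegral_const, mul_comm]
      _ ≤ ∫⁻ y in S, (2 * ‖u p - u y‖ₑ ^ 2 + 2 * ‖u y - ubar‖ₑ ^ 2) :=
          lintegral_mono fun y => enorm_sub_sq_le_two_mul_add _ _ _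
      _ = 2 * (∫⁻ y in S, ‖u p - u y‖ₑ ^ 2) + 2 * ∫⁻ y in S, ‖u y - ubar‖ₑ ^ 2 := by
          rw [lintegral_add_right' _ haeS, lintegral_const_mul' _ _ (by norm_num),
            lintegral_const_mul' _ _ (by norm_num)]
      _ ≤ _ := by gcongr
  have hmain : volume S * ∫⁻ p, ‖u p - ubar‖ₑ ^ 2 ∂ν ≤
      24 * D ^ 3 * Γ + volume S * (2 * D ^ 2 * ENNReal.ofReal (4 / r) * Γ) := by
    calc volume S * ∫⁻ p, ‖u p - ubar‖ₑ ^ 2 ∂ν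
        = ∫⁻ p, volume S * ‖u p - ubar‖ₑ ^ 2 ∂ν := (lintegral_const_mul' _ _ hbtop).symm
      _ ≤ ∫⁻ p, (2 * (∫⁻ y in S, ‖u p - u y‖ₑ ^ 2) + 2 * (8 * D ^ 2 * Γ)) ∂ν :=
          lintegral_mono hpt
      _ = 2 * (∫⁻ p, (∫⁻ y in S, ‖u p - u y‖ₑ ^ 2) ∂ν) + 2 * (8 * D ^ 2 * Γ) * ν Set.univ := by
          rw [lintegral_add_right _ measurable_const, lintegral_const_mul' _ _ (by norm_num),
            lintegral_const]
      _ ≤ 2 * (D ^ 2 * (4 * D * Γ + volume S * (ENNReal.ofReal (4 / r) * Γ))) +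
            2 * (8 * D ^ 2 * Γ) * D := by gcongr
      _ = _ := by ring
  refine (ENNReal.mul_le_mul_iff_right hb0 hbtop).1 (hmain.trans ?_)
  have h1 : 24 * D ^ 3 ≤ volume S * ENNReal.ofReal (48 * d ^ 3 / r ^ 2) := by
    have h24 : (24 : ℝ≥0∞) = ENNReal.ofReal 24 := by norm_num
    calc 24 * D ^ 3 = ENNReal.ofReal (r ^ 2 / 2) * ENNReal.ofReal (48 * d ^ 3 / r ^ 2) := by
          rw [h24, ← ENNReal.ofReal_pow hd0, ← ENNReal.ofReal_mul (by norm_num),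
            ← ENNReal.ofReal_mul (by positivity)]
          congr 1
          field_simp
          ring
      _ ≤ _ := by
          gcongr
          exact ofReal_le_volume_ball_half c hr
  have h2 : 2 * D ^ 2 * ENNReal.ofReal (4 / r) = ENNReal.ofReal (8 * d ^ 2 / r) := by
    have h2 : (2 : ℝ≥0∞) = ENNReal.ofReal 2 := by norm_num
    rw [h2, ← ENNReal.ofReal_pow hd0, ← ENNReal.ofReal_mul (by norm_num),
      ← ENNReal.ofReal_mul (by positivity)]
    congr 1
    ring
  rw [h2, ENNReal.ofReal_add (by positivity) (by positivity)]
  calc _ ≤ volume S * ENNReal.ofReal (48 * d ^ 3 / r ^ 2) * Γ +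
        volume S * (ENNReal.ofReal (8 * d ^ 2 / r) * Γ) := by gcongr
    _ = _ := by ring

/-- Two points that are equal or at least `δ` apart coincide when they lie in the same cell of the
square grid of mesh `δ / 2`. -/
theorem eq_of_floor_eq {v w c : Plane} {δ : ℝ} (hδ : 0 < δ) (hsep : v ≠ w → δ ≤ dist v w)
    (h : ∀ i, ⌊(v i - c i) / (δ / 2)⌋ = ⌊(w i - c i) / (δ / 2)⌋) : v = w := by
  by_contra hne
  have hi : ∀ i, |v i - w i| < δ / 2 := by
    intro i
    have h1 := Int.abs_sub_lt_one_of_floor_eq_floor (h i)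
    rw [← sub_div, sub_sub_sub_cancel_right, abs_div, abs_of_pos (half_pos hδ),
      div_lt_one (half_pos hδ)] at h1
    exact h1
  have h2 := EuclideanSpace.real_norm_sq_eq (v - w)
  rw [← dist_eq_norm, Fin.sum_univ_two] at h2
  simp only [PiLp.sub_apply] at h2
  have h3 := sq_lt_sq' (abs_lt.1 (hi 0)).1 (abs_lt.1 (hi 0)).2
  have h4 := sq_lt_sq' (abs_lt.1 (hi 1)).1 (abs_lt.1 (hi 1)).2
  nlinarith [hsep hne]

theorem floor_mem_Icc {v c : Plane} {d γ : ℝ} (hd : 0 < d) (hγ : 0 < γ) (h : dist v c ≤ d)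
    (i : Fin 2) :
    ⌊(v i - c i) / (γ * d / 2)⌋ ∈ Finset.Icc (-(⌈2 / γ⌉₊ : ℤ)) ⌈2 / γ⌉₊ := by
  have h1 : |v i - c i| ≤ d := by
    have := PiLp.norm_apply_le (v - c) i
    rw [← dist_eq_norm] at this
    exact this.trans h
  have hpos : 0 < γ * d / 2 := by positivity
  have h2 : |(v i - c i) / (γ * d / 2)| ≤ ⌈2 / γ⌉₊ := by
    refine le_trans ?_ (Nat.le_ceil _)
    rw [abs_div, abs_of_pos hpos, div_le_div_iff₀ hpos hγ]
    nlinarith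
  rw [abs_le] at h2
  rw [Finset.mem_Icc]
  constructor
  · rw [Int.le_floor]
    push_cast
    exact h2.1
  · rw [← Int.cast_le (R := ℝ)]
    push_cast
    exact (Int.floor_le _).trans h2.2

theorem card_edges_le {m : ℕ} {A B : Fin m → Plane} {c : Plane} {d γ : ℝ} (hd : 0 < d)
    (hγ : 0 < γ) (hAB : ∀ i, A i ≠ B i)
    (hmeet : ∀ i j, i ≠ j → segment ℝ (A i) (B i) ∩ segment ℝ (A j) (B j) ⊆
      ({A i, B i} : Set Plane) ∩ {A j, B j})
    (hsep : ∀ v ∈ Set.range A ∪ Set.range B, ∀ w ∈ Set.range A ∪ Set.range B,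
      v ≠ w → γ * d ≤ dist v w)
    (hA : ∀ i, dist (A i) c ≤ d) (hB : ∀ i, dist (B i) c ≤ d) :
    m ≤ (2 * ⌈2 / γ⌉₊ + 1) ^ 4 := by
  let I := Finset.Icc (-(⌈2 / γ⌉₊ : ℤ)) ⌈2 / γ⌉₊
  let cell : Plane → ℤ × ℤ := fun v =>
    (⌊(v 0 - c 0) / (γ * d / 2)⌋, ⌊(v 1 - c 1) / (γ * d / 2)⌋)
  have hcell : ∀ v, dist v c ≤ d → cell v ∈ I ×ˢ I := fun v hv =>
    Finset.mem_product.2 ⟨floor_mem_Icc hd hγ hv 0, floor_mem_Icc hd hγ hv 1⟩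
  have hinj : ∀ v ∈ Set.range A ∪ Set.range B, ∀ w ∈ Set.range A ∪ Set.range B,
      cell v = cell w → v = w := by
    intro v hv w hw h
    refine eq_of_floor_eq (c := c) (mul_pos hγ hd) (hsep v hv w hw) fun i => ?_
    fin_cases i
    · exact congrArg Prod.fst h
    · exact congrArg Prod.snd h
  have hcard : (Finset.univ : Finset (Fin m)).card ≤ ((I ×ˢ I) ×ˢ (I ×ˢ I)).card := by
    refine Finset.card_le_card_of_injOn (fun i => (cell (A i), cell (B i)))
      (fun i _ => Finset.mem_product.2 ⟨hcell _ (hA i), hcell _ (hB i)⟩) ?_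
    intro i _ j _ hij
    by_contra hne
    have hAij : A i = A j := hinj _ (Or.inl ⟨i, rfl⟩) _ (Or.inl ⟨j, rfl⟩) (congrArg Prod.fst hij)
    have hBij : B i = B j := hinj _ (Or.inr ⟨i, rfl⟩) _ (Or.inr ⟨j, rfl⟩) (congrArg Prod.snd hij)
    have hmid := midpoint_mem_segment (𝕜 := ℝ) (A i) (B i)
    have h := (hmeet i j hne ⟨hmid, by rwa [← hAij, ← hBij]⟩).1
    rcases h with h | h
    · exact hAB i ((midpoint_eq_left_iff ℝ).1 h)
    · exact hAB i ((midpoint_eq_right_iff ℝ).1 h)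
  have hI : I.card = 2 * ⌈2 / γ⌉₊ + 1 := by
    rw [Int.card_Icc]
    omega
  rw [Finset.card_univ, Fintype.card_fin, Finset.card_product, Finset.card_product, hI] at hcard
  exact hcard.trans_eq (by ring)

theorem stmt_14 (γ₀ γ₁ : ℝ) (hγ₀ : 0 < γ₀) (hγ₁ : 0 < γ₁) :
    ∃ C : ℝ, 0 < C ∧
      ∀ K : Set (EuclideanSpace ℝ (Fin 2)), K.Nonempty → IsOpen K → Bornology.IsBounded K →
      -- the boundary of `K` is the union of the closed straight edges `[A i, B i]`
      ∀ (m : ℕ) (A B : Fin m → EuclideanSpace ℝ (Fin 2)),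
        (∀ i, A i ≠ B i) →
        frontier K = ⋃ i, segment ℝ (A i) (B i) →
        -- distinct edges meet only at vertices
        (∀ i j, i ≠ j → segment ℝ (A i) (B i) ∩ segment ℝ (A j) (B j) ⊆
          ({A i, B i} : Set (EuclideanSpace ℝ (Fin 2))) ∩ {A j, B j}) →
        -- distance between any two vertices is at least `γ₁ * diam K`
        (∀ v ∈ Set.range A ∪ Set.range B, ∀ w ∈ Set.range A ∪ Set.range B,
          v ≠ w → γ₁ * Metric.diam K ≤ dist v w) →
        -- star-shapedness with respect to a ball of radius `γ₀ * diam K`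
        (∃ c : EuclideanSpace ℝ (Fin 2),
          Metric.closedBall c (γ₀ * Metric.diam K) ⊆ K ∧
          ∀ y ∈ Metric.closedBall c (γ₀ * Metric.diam K), ∀ z ∈ K, segment ℝ y z ⊆ K) →
      ∀ u : EuclideanSpace ℝ (Fin 2) → ℝ,
        (∃ U : Set (EuclideanSpace ℝ (Fin 2)),
          IsOpen U ∧ closure K ⊆ U ∧ ContDiffOn ℝ 1 u U) →
        (∫ x in frontier K,
            (u x - ((volume K).toReal)⁻¹ * ∫ z in K, u z) ^ 2 ∂μH[1]) ≤
          C * Metric.diam K * ∫ x in K, ‖fderiv ℝ u x‖ ^ 2 := by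
  let N : ℝ := ((2 * ⌈2 / γ₁⌉₊ + 1) ^ 4 : ℕ)
  have hN : 0 < N := by positivity
  refine ⟨N * (48 / γ₀ ^ 2 + 8 / γ₀), by positivity, ?_⟩
  rintro K hKne hK hb m A B hAB hfront hmeet hsep ⟨c, hcK, hstar⟩ u ⟨U, hU, hKU, hu⟩
  set d := Metric.diam K
  have hd0 : 0 < d := by
    obtain ⟨x, hx⟩ := hKne
    obtain ⟨ε, hε, hball⟩ := Metric.isOpen_iff.1 hK x hx
    have hy : x + EuclideanSpace.single 0 (ε / 2) ∈ K := hball (by simp [abs_of_pos hε, hε])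
    have h := Metric.dist_le_diam_of_mem hb hy hx
    rw [dist_self_add_left] at h
    simp only [PiLp.norm_single, Real.norm_eq_abs, abs_of_pos (half_pos hε)] at h
    linarith
  have hc : c ∈ K := hcK (Metric.mem_closedBall_self (by positivity))
  have hr : 0 < γ₀ * d := by positivity
  have hsub : ∀ i, segment ℝ (A i) (B i) ⊆ frontier K := fun i => by
    rw [hfront]
    exact Set.subset_iUnion (fun i => segment ℝ (A i) (B i)) i
  have hcl : ∀ i, ∀ p ∈ segment ℝ (A i) (B i), dist p c ≤ d := fun i p hp =>
    dist_le_diam_of_mem_closure hb (frontier_subset_closure (hsub i hp)) (subset_closure hc)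
  have hm : (m : ℝ) ≤ N := Nat.cast_le.2 (card_edges_le hd0 hγ₁ hAB hmeet hsep
    (fun i => hcl i _ (left_mem_segment ℝ _ _)) fun i => hcl i _ (right_mem_segment ℝ _ _))
  have hedge := fun i => lintegral_segment_enorm_sub_average_sq_le hK hb hU hKU hu hr
    (Metric.ball_subset_closedBall.trans hcK)
    (fun y hy => hstar y (Metric.ball_subset_closedBall hy)) (hAB i) (hsub i)
  set ubar := (volume K).toReal⁻¹ * ∫ z in K, u z
  have hint : IntegrableOn (fun x => ‖fderiv ℝ u x‖ ^ 2) K :=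
    ((((hu.continuousOn_fderiv_of_isOpen hU le_rfl).mono hKU).norm.pow 2).integrableOn_compact
      hb.isCompact_closure).mono_set subset_closure
  have hΓ : ∫⁻ z in K, ‖fderiv ℝ u z‖ₑ ^ 2 = ENNReal.ofReal (∫ x in K, ‖fderiv ℝ u x‖ ^ 2) := by
    rw [ofReal_integral_eq_lintegral_ofReal hint (ae_of_all _ fun x => by positivity)]
    refine lintegral_congr fun x => ?_
    rw [ENNReal.ofReal_pow (norm_nonneg _), ofReal_norm]
  have hI0 : 0 ≤ ∫ x in K, ‖fderiv ℝ u x‖ ^ 2 := integral_nonneg fun x => by positivity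
  set J := ∫ x in K, ‖fderiv ℝ u x‖ ^ 2
  rw [← ENNReal.ofReal_le_ofReal_iff (by positivity)]
  calc ENNReal.ofReal (∫ x in frontier K, (u x - ubar) ^ 2 ∂μH[1])
      ≤ ‖∫ x in frontier K, (u x - ubar) ^ 2 ∂μH[1]‖ₑ := by
        rw [← ofReal_norm]
        exact ENNReal.ofReal_le_ofReal (le_abs_self _)
    _ ≤ ∫⁻ x in frontier K, ‖u x - ubar‖ₑ ^ 2 ∂μH[1] :=
        (enorm_integral_le_lintegral_enorm _).trans_eq (by simp only [enorm_pow])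
    _ ≤ ∑' i, ∫⁻ x in segment ℝ (A i) (B i), ‖u x - ubar‖ₑ ^ 2 ∂μH[1] := by
        rw [hfront]
        exact lintegral_iUnion_le _ _
    _ ≤ ∑ _i : Fin m, ENNReal.ofReal
          (48 * d ^ 3 / (γ₀ * d) ^ 2 + 8 * d ^ 2 / (γ₀ * d)) * ENNReal.ofReal J := by
        rw [tsum_fintype, ← hΓ]
        exact Finset.sum_le_sum fun i _ => hedge i
    _ = ENNReal.ofReal (m * ((48 / γ₀ ^ 2 + 8 / γ₀) * d * J)) := by
        rw [Finset.sum_const, Finset.card_univ, Fintype.card_fin, nsmul_eq_mul,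
          ← ENNReal.ofReal_mul (by positivity), ← ENNReal.ofReal_natCast,
          ← ENNReal.ofReal_mul (by positivity)]
        congr 2
        field_simp
    _ ≤ ENNReal.ofReal (N * (48 / γ₀ ^ 2 + 8 / γ₀) * d * J) := by
        apply ENNReal.ofReal_le_ofReal
        rw [mul_assoc N, mul_assoc N]
        gcongr
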